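/- For any τ in the upper half-plane with q = exp(πiτ), and every complex number z, the Jacobi infinite product expression θ₃(z|τ) = (q²;q²)_∞ · (−q e^{2iz};q²)_∞ · (−q e^{−2iz};q²)_∞ holds. -/

import Mathlib

open Complex

/-- Jacobi theta function θ₁(z|τ) with nome q = exp(πiτ). -/
noncomputable def theta1 (z τ : ℂ) : ℂ :=
  -I * exp ((Real.pi : ℂ) * I * τ / 4) *
    ∑' k : ℤ, (-1 : ℂ) ^ k * exp ((Real.pi : ℂ) * I * τ * ((k : ℂ) * ((k : ℂ) + 1))) *
      exp ((2 * (k : ℂ) + 1) * z * I)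

/-- Jacobi theta function θ₂(z|τ) with nome q = exp(πiτ). -/
noncomputable def theta2 (z τ : ℂ) : ℂ :=
  exp ((Real.pi : ℂ) * I * τ / 4) *
    ∑' k : ℤ, exp ((Real.pi : ℂ) * I * τ * ((k : ℂ) * ((k : ℂ) + 1))) *
      exp ((2 * (k : ℂ) + 1) * z * I)

/-- Jacobi theta function θ₃(z|τ) with nome q = exp(πiτ). -/
noncomputable def theta3 (z τ : ℂ) : ℂ :=
  ∑' k : ℤ, exp ((Real.pi : ℂ) * I * τ * ((k : ℂ) ^ 2)) * exp (2 * (k : ℂ) * z * I)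

/-- Jacobi theta function θ₄(z|τ) with nome q = exp(πiτ). -/
noncomputable def theta4 (z τ : ℂ) : ℂ :=
  ∑' k : ℤ, (-1 : ℂ) ^ k * exp ((Real.pi : ℂ) * I * τ * ((k : ℂ) ^ 2)) * exp (2 * (k : ℂ) * z * I)

/-- The q-shifted factorial (a;q)_∞ = ∏_{n≥0} (1 - a qⁿ). -/
noncomputable def qpoch (a q : ℂ) : ℂ := ∏' n : ℕ, (1 - a * q ^ n)

open Filter Topology Finset

/-- The Gaussian binomial coefficient with base `Q`, defined by the `q`-Pascal rule. -/
noncomputable def gaussBinom (Q : ℂ) : ℕ → ℕ → ℂ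
  | _, 0 => 1
  | 0, _ + 1 => 0
  | n + 1, k + 1 => gaussBinom Q n k + Q ^ (k + 1) * gaussBinom Q n (k + 1)

lemma gaussBinom_zero_right (Q : ℂ) (n : ℕ) : gaussBinom Q n 0 = 1 := by
  cases n <;> rfl

lemma gaussBinom_succ_succ (Q : ℂ) (n k : ℕ) :
    gaussBinom Q (n + 1) (k + 1) = gaussBinom Q n k + Q ^ (k + 1) * gaussBinom Q n (k + 1) := rfl

lemma gaussBinom_eq_zero_of_lt (Q : ℂ) {n k : ℕ} (h : n < k) : gaussBinom Q n k = 0 := by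
  induction n generalizing k with
  | zero =>
    obtain ⟨k, rfl⟩ := Nat.exists_eq_succ_of_ne_zero h.ne'
    rfl
  | succ n ih =>
    obtain ⟨k, rfl⟩ := Nat.exists_eq_succ_of_ne_zero (Nat.ne_zero_of_lt h)
    rw [Nat.succ_eq_add_one, gaussBinom_succ_succ, ih (by omega), ih (by omega)]
    simp

lemma gaussBinom_self (Q : ℂ) (n : ℕ) : gaussBinom Q n n = 1 := by
  induction n with
  | zero => rfl
  | succ n ih => rw [gaussBinom_succ_succ, ih, gaussBinom_eq_zero_of_lt Q n.lt_succ_self]; simp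

/-- The finite product `(Q; Q)_n`. -/
noncomputable def qpochSelf (Q : ℂ) (n : ℕ) : ℂ := ∏ i ∈ range n, (1 - Q * Q ^ i)

lemma qpochSelf_succ (Q : ℂ) (n : ℕ) :
    qpochSelf Q (n + 1) = qpochSelf Q n * (1 - Q * Q ^ n) := prod_range_succ _ _

lemma qpochSelf_mul_gaussBinom (Q : ℂ) (m r : ℕ) :
    qpochSelf Q m * qpochSelf Q r * gaussBinom Q (m + r) m = qpochSelf Q (m + r) := by
  induction m generalizing r with
  | zero => simp [gaussBinom_zero_right, qpochSelf]
  | succ m ihm =>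
    induction r with
    | zero => simp [gaussBinom_self, qpochSelf]
    | succ r ihr =>
      have h := ihm (r + 1)
      rw [show m + 1 + (r + 1) = (m + (r + 1)) + 1 by ring, gaussBinom_succ_succ,
        qpochSelf_succ Q (m + (r + 1))]
      rw [show m + 1 + r = m + (r + 1) by ring] at ihr
      rw [qpochSelf_succ] at h ihr ⊢
      rw [qpochSelf_succ Q r]
      linear_combination (1 - Q * Q ^ m) * h + Q ^ (m + 1) * (1 - Q * Q ^ r) * ihr

/-- The `q`-binomial theorem. -/
lemma prod_one_add_eq_sum_gaussBinom (q w : ℂ) (n : ℕ) :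
    ∏ i ∈ range n, (1 + w * q ^ (2 * i + 1)) =
      ∑ j ∈ range (n + 1), gaussBinom (q ^ 2) n j * q ^ (j ^ 2) * w ^ j := by
  induction n generalizing w with
  | zero => simp [gaussBinom_zero_right]
  | succ n ih =>
    have h : ∏ i ∈ range (n + 1), (1 + w * q ^ (2 * i + 1)) =
        (1 + w * q) * ∏ i ∈ range n, (1 + (w * q ^ 2) * q ^ (2 * i + 1)) := by
      rw [prod_range_succ', mul_comm]
      congr 1
      · simp
      · exact prod_congr rfl fun i _ ↦ by ring
    rw [h, ih, sum_range_succ' _ (n + 1)]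
    have e : ∑ j ∈ range (n + 1), gaussBinom (q ^ 2) n j * q ^ (j ^ 2) * (w * q ^ 2) ^ j =
        (∑ j ∈ range (n + 1),
          gaussBinom (q ^ 2) n (j + 1) * q ^ ((j + 1) ^ 2) * (w * q ^ 2) ^ (j + 1)) + 1 := by
      have := sum_range_succ'
        (fun j ↦ gaussBinom (q ^ 2) n j * q ^ (j ^ 2) * (w * q ^ 2) ^ j) (n + 1)
      rw [sum_range_succ, gaussBinom_eq_zero_of_lt _ n.lt_succ_self] at this
      simpa [gaussBinom_zero_right] using this
    rw [add_mul, one_mul]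
    nth_rewrite 1 [e]
    rw [add_right_comm, mul_sum, ← sum_add_distrib]
    congr 1
    · refine sum_congr rfl fun j _ ↦ ?_
      rw [gaussBinom_succ_succ]
      ring
    · simp [gaussBinom_zero_right]

/-- The finite form of the Jacobi triple product. -/
lemma prod_mul_prod_eq_sum_gaussBinom {q w : ℂ} (hq : q ≠ 0) (hw : w ≠ 0) (n m : ℕ) :
    (∏ i ∈ range n, (1 + w * q ^ (2 * i + 1))) *
        ∏ i ∈ range m, (1 + w⁻¹ * q ^ (2 * i + 1)) =
      ∑ j ∈ range (n + m + 1),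
        gaussBinom (q ^ 2) (n + m) j * q ^ (((j : ℤ) - m) ^ 2) * w ^ ((j : ℤ) - m) := by
  induction m generalizing n w with
  | zero =>
    simp only [prod_range_zero, mul_one, prod_one_add_eq_sum_gaussBinom, add_zero]
    refine sum_congr rfl fun j _ ↦ ?_
    simp only [Nat.cast_zero, sub_zero]
    norm_cast
  | succ m ih =>
    have hv : w * (q ^ 2)⁻¹ ≠ 0 := by positivity
    have h := ih hv (n + 1)
    have e : (∏ i ∈ range n, (1 + w * q ^ (2 * i + 1))) *
        ∏ i ∈ range (m + 1), (1 + w⁻¹ * q ^ (2 * i + 1)) =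
        w⁻¹ * q * ((∏ i ∈ range (n + 1), (1 + w * (q ^ 2)⁻¹ * q ^ (2 * i + 1))) *
          ∏ i ∈ range m, (1 + (w * (q ^ 2)⁻¹)⁻¹ * q ^ (2 * i + 1))) := by
      rw [prod_range_succ', prod_range_succ' _ n]
      have h1 : ∏ i ∈ range n, (1 + w * (q ^ 2)⁻¹ * q ^ (2 * (i + 1) + 1)) =
          ∏ i ∈ range n, (1 + w * q ^ (2 * i + 1)) :=
        prod_congr rfl fun i _ ↦ by field_simp; ring
      have h2 : ∏ i ∈ range m, (1 + (w * (q ^ 2)⁻¹)⁻¹ * q ^ (2 * i + 1)) =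
          ∏ i ∈ range m, (1 + w⁻¹ * q ^ (2 * (i + 1) + 1)) :=
        prod_congr rfl fun i _ ↦ by field_simp; ring
      rw [h1, h2]
      have h3 : w⁻¹ * q * (1 + w * (q ^ 2)⁻¹ * q ^ (2 * 0 + 1)) =
          1 + w⁻¹ * q ^ (2 * 0 + 1) := by
        field_simp; ring
      rw [← h3]
      ring
    rw [e, h, mul_sum, show n + 1 + m = n + (m + 1) by ring]
    refine sum_congr rfl fun j _ ↦ ?_
    set a : ℤ := (j : ℤ) - m with ha
    have ha' : (j : ℤ) - (m + 1 : ℕ) = a - 1 := by push_cast; ring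
    rw [ha', mul_zpow, zpow_sub_one₀ hw, show (a - 1) ^ 2 = a ^ 2 + (-2 * a) + 1 by ring,
      zpow_add_one₀ hq, zpow_add₀ hq, zpow_mul]
    have : q ^ (-2 : ℤ) = (q ^ 2)⁻¹ := by rw [zpow_neg]; norm_cast
    rw [this]
    ring

lemma summable_norm_mul_pow {Q : ℂ} (hQ : ‖Q‖ < 1) (a : ℂ) :
    Summable fun n : ℕ ↦ ‖-(a * Q ^ n)‖ := by
  simpa using (summable_geometric_of_lt_one (norm_nonneg Q) hQ).mul_left ‖a‖

lemma tendsto_prod_qpoch {Q : ℂ} (hQ : ‖Q‖ < 1) (a : ℂ) :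
    Tendsto (fun n ↦ ∏ i ∈ range n, (1 - a * Q ^ i)) atTop (𝓝 (qpoch a Q)) := by
  have h := (multipliable_one_add_of_summable (summable_norm_mul_pow hQ a)).tendsto_prod_tprod_nat
  simpa only [qpoch, ← sub_eq_add_neg] using h

lemma one_sub_mul_pow_ne_zero {Q : ℂ} (hQ : ‖Q‖ < 1) (n : ℕ) : 1 - Q * Q ^ n ≠ 0 := by
  intro h
  have h1 : ‖Q ^ (n + 1)‖ = 1 := by
    rw [pow_succ', ← sub_eq_zero.mp h, norm_one]
  rw [norm_pow] at h1
  exact (pow_lt_one₀ (norm_nonneg Q) hQ n.succ_ne_zero).ne h1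

lemma qpochSelf_ne_zero {Q : ℂ} (hQ : ‖Q‖ < 1) (n : ℕ) : qpochSelf Q n ≠ 0 :=
  prod_ne_zero_iff.mpr fun i _ ↦ one_sub_mul_pow_ne_zero hQ i

lemma qpoch_self_ne_zero {Q : ℂ} (hQ : ‖Q‖ < 1) : qpoch Q Q ≠ 0 := by
  have h := tprod_one_add_ne_zero_of_summable (f := fun n : ℕ ↦ -(Q * Q ^ n))
    (fun n ↦ by simpa only [← sub_eq_add_neg] using one_sub_mul_pow_ne_zero hQ n)
    (summable_norm_mul_pow hQ Q)
  simpa only [qpoch, ← sub_eq_add_neg] using h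

lemma gaussBinom_add_eq_div {Q : ℂ} (hQ : ‖Q‖ < 1) (m r : ℕ) :
    gaussBinom Q (m + r) m = qpochSelf Q (m + r) * (qpochSelf Q m)⁻¹ * (qpochSelf Q r)⁻¹ := by
  have h1 := qpochSelf_ne_zero hQ m
  have h2 := qpochSelf_ne_zero hQ r
  rw [← qpochSelf_mul_gaussBinom]
  field_simp

lemma exists_norm_gaussBinom_le {Q : ℂ} (hQ : ‖Q‖ < 1) :
    ∃ C : ℝ, 0 ≤ C ∧ ∀ n k, ‖gaussBinom Q n k‖ ≤ C := by
  have ht : Tendsto (qpochSelf Q) atTop (𝓝 (qpoch Q Q)) := tendsto_prod_qpoch hQ Q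
  obtain ⟨A, hA⟩ := (Metric.isBounded_range_of_tendsto _ ht).exists_norm_le
  obtain ⟨B, hB⟩ :=
    (Metric.isBounded_range_of_tendsto _ (ht.inv₀ (qpoch_self_ne_zero hQ))).exists_norm_le
  have hA' (n) : ‖qpochSelf Q n‖ ≤ A := hA _ ⟨n, rfl⟩
  have hB' (n) : ‖(qpochSelf Q n)⁻¹‖ ≤ B := hB _ ⟨n, rfl⟩
  have hA0 : 0 ≤ A := (norm_nonneg _).trans (hA' 0)
  have hB0 : 0 ≤ B := (norm_nonneg _).trans (hB' 0)
  refine ⟨A * B * B, by positivity, fun n k ↦ ?_⟩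
  rcases lt_or_ge n k with h | h
  · rw [gaussBinom_eq_zero_of_lt Q h, norm_zero]
    positivity
  · obtain ⟨r, rfl⟩ := Nat.exists_eq_add_of_le h
    rw [gaussBinom_add_eq_div hQ, norm_mul, norm_mul]
    gcongr
    exacts [hA' _, hB' _, hB' _]

lemma tendsto_gaussBinom_central {Q : ℂ} (hQ : ‖Q‖ < 1) (k : ℤ) :
    Tendsto (fun n : ℕ ↦ gaussBinom Q (n + n) (k + n).toNat) atTop (𝓝 (qpoch Q Q)⁻¹) := by
  have ht : Tendsto (qpochSelf Q) atTop (𝓝 (qpoch Q Q)) := tendsto_prod_qpoch hQ Q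
  have h0 := qpoch_self_ne_zero hQ
  have hshift (l : ℤ) : Tendsto (fun n : ℕ ↦ (l + n).toNat) atTop atTop :=
    tendsto_atTop_atTop.mpr fun b ↦ ⟨b + l.natAbs, fun n hn ↦ by omega⟩
  have hdouble : Tendsto (fun n : ℕ ↦ n + n) atTop atTop :=
    tendsto_atTop_atTop.mpr fun b ↦ ⟨b, fun n hn ↦ by omega⟩
  have h := ((ht.comp hdouble).mul ((ht.inv₀ h0).comp (hshift k))).mul
    ((ht.inv₀ h0).comp (hshift (-k)))
  rw [mul_inv_cancel₀ h0, one_mul] at h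
  refine h.congr' ?_
  filter_upwards [eventually_ge_atTop k.natAbs] with n hn
  have e : n + n = (k + n).toNat + (-k + n).toNat := by omega
  simp only [Function.comp_apply]
  rw [e, gaussBinom_add_eq_div hQ]

/-- The Jacobi triple product, in the variables `q` and `w`. -/
lemma tsum_zpow_eq_qpoch_mul {q w : ℂ} (hq0 : q ≠ 0) (hq : ‖q‖ < 1) (hw : w ≠ 0)
    (hs : Summable fun k : ℤ ↦ ‖q ^ (k ^ 2) * w ^ k‖) :
    ∑' k : ℤ, q ^ (k ^ 2) * w ^ k =
      qpoch (q ^ 2) (q ^ 2) * qpoch (-(q * w)) (q ^ 2) * qpoch (-(q * w⁻¹)) (q ^ 2) := by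
  have hQ : ‖q ^ 2‖ < 1 := by
    rw [norm_pow]
    exact pow_lt_one₀ (norm_nonneg q) hq two_ne_zero
  have hQ0 := qpoch_self_ne_zero hQ
  obtain ⟨C, hC0, hC⟩ := exists_norm_gaussBinom_le hQ
  let f (n : ℕ) (k : ℤ) : ℂ :=
    if k ∈ Icc (-n : ℤ) n then gaussBinom (q ^ 2) (n + n) (k + n).toNat * (q ^ (k ^ 2) * w ^ k)
    else 0
  have hf (n : ℕ) : ∑' k, f n k = (∏ i ∈ range n, (1 - -(q * w) * (q ^ 2) ^ i)) *
      ∏ i ∈ range n, (1 - -(q * w⁻¹) * (q ^ 2) ^ i) := by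
    have e (v : ℂ) : ∏ i ∈ range n, (1 - -(q * v) * (q ^ 2) ^ i) =
        ∏ i ∈ range n, (1 + v * q ^ (2 * i + 1)) := prod_congr rfl fun i _ ↦ by ring
    rw [e, e, prod_mul_prod_eq_sum_gaussBinom hq0 hw,
      tsum_eq_sum (s := Icc (-n : ℤ) n) fun k hk ↦ if_neg hk]
    refine sum_nbij' (fun k ↦ (k + n).toNat) (fun j ↦ (j : ℤ) - n) ?_ ?_ ?_ ?_ ?_
    · intro k hk
      simp only [mem_Icc, mem_range] at hk ⊢
      omega
    · intro j hj
      simp only [mem_Icc, mem_range] at hj ⊢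
      omega
    · intro k hk
      simp only [mem_Icc] at hk
      omega
    · intro j hj
      omega
    · intro k hk
      have hk' := mem_Icc.mp hk
      have : (((k + n).toNat : ℕ) : ℤ) - n = k := by omega
      rw [this, mul_assoc]
      exact if_pos hk
  have hlim : Tendsto (fun n ↦ ∑' k, f n k) atTop
      (𝓝 (∑' k : ℤ, (qpoch (q ^ 2) (q ^ 2))⁻¹ * (q ^ (k ^ 2) * w ^ k))) := by
    refine tendsto_tsum_of_dominated_convergence (hs.mul_left C) (fun k ↦ ?_)
      (Eventually.of_forall fun n k ↦ ?_)
    · refine ((tendsto_gaussBinom_central hQ k).mul_const _).congr' ?_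
      filter_upwards [eventually_ge_atTop k.natAbs] with n hn
      exact (if_pos (mem_Icc.mpr (by omega))).symm
    · by_cases hk : k ∈ Icc (-n : ℤ) n
      · simp only [f, if_pos hk]
        rw [norm_mul]
        gcongr
        exact hC _ _
      · simp only [f, if_neg hk, norm_zero]
        positivity
  simp only [hf] at hlim
  have huniq := tendsto_nhds_unique hlim
    ((tendsto_prod_qpoch hQ (-(q * w))).mul (tendsto_prod_qpoch hQ (-(q * w⁻¹))))
  rw [tsum_mul_left, inv_mul_eq_iff_eq_mul₀ hQ0] at huniq
  rw [huniq, mul_assoc]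

theorem theta3_product_formula (τ : ℂ) (hτ : 0 < τ.im) (z : ℂ) :
    theta3 z τ =
      qpoch (exp ((Real.pi : ℂ) * I * τ) ^ 2) (exp ((Real.pi : ℂ) * I * τ) ^ 2) *
        qpoch (-(exp ((Real.pi : ℂ) * I * τ) * exp (2 * z * I))) (exp ((Real.pi : ℂ) * I * τ) ^ 2) *
        qpoch (-(exp ((Real.pi : ℂ) * I * τ) * exp (-(2 * z * I)))) (exp ((Real.pi : ℂ) * I * τ) ^ 2) := by
  have hterm (k : ℤ) : exp ((Real.pi : ℂ) * I * τ * ((k : ℂ) ^ 2)) * exp (2 * (k : ℂ) * z * I) =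
      exp ((Real.pi : ℂ) * I * τ) ^ (k ^ 2) * exp (2 * z * I) ^ k := by
    rw [← exp_int_mul, ← exp_int_mul]
    push_cast
    ring_nf
  have hs : Summable fun k : ℤ ↦
      ‖exp ((Real.pi : ℂ) * I * τ) ^ (k ^ 2) * exp (2 * z * I) ^ k‖ := by
    refine ((summable_jacobiTheta₂_term_iff (z / Real.pi) τ).mpr hτ).norm.congr fun k ↦ ?_
    rw [← hterm, jacobiTheta₂_term, ← exp_add]
    have hpi : (Real.pi : ℂ) ≠ 0 := ofReal_ne_zero.mpr Real.pi_ne_zero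
    congr 2
    field_simp
    ring
  have hq : ‖exp ((Real.pi : ℂ) * I * τ)‖ < 1 := by
    rw [norm_exp, Real.exp_lt_one_iff]
    simpa using mul_pos Real.pi_pos hτ
  rw [theta3, tsum_congr hterm, exp_neg (2 * z * I)]
  exact tsum_zpow_eq_qpoch_mul (exp_ne_zero _) hq (exp_ne_zero _) hs
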